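/- arXiv:1701.03172 — 2 statements merged into one kernel-verified Lean document; each statement's English description precedes it below -/
import Mathlib

section
/- Let (V, W) be a partition of I (V ∪ W = I, V ∩ W = ∅) and let L(V,W) be the set of lines with one endpoint in V and the other in W. Suppose Σ_{i∈V} D_i > Σ_{j : loc(j) ∈ V} P_j + Σ_{i ∈ Ψ∩V} k_i u_i. Then every market-clearing solution with no load shedding in V (s_i = 0 for all i ∈ V) satisfies Σ_{l∈L(V,W)} z_l ≥ 1 (key step in the proof of Proposition 3). -/
open Finset

variable {I L Ω : Type*} [Fintype I] [Fintype L] [Fintype Ω] [DecidableEq I]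

/-- Data of a DC power network with a single demand block. -/
structure PowerNetwork (I L Ω : Type*) [Fintype I] [Fintype L] [Fintype Ω] where
  o : L → I
  d : L → I
  D : I → ℝ
  loc : Ω → I
  P : Ω → ℝ
  Ψ : Finset I
  k : I → ℝ
  S : L → ℝ
  fbar : L → ℝ
  θbar : ℝ
  hD : ∀ i, 0 ≤ D i
  hP : ∀ j, 0 ≤ P j
  hk : ∀ i, 0 ≤ k i ∧ k i ≤ 1
  hfbar : ∀ l, 0 < fbar l
  hθbar : 0 < θbar

/-- A market-clearing solution for installed wind capacities `u`. -/
def IsMarketClearing (N : PowerNetwork I L Ω) (u : I → ℝ)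
    (g : Ω → ℝ) (gw : I → ℝ) (s : I → ℝ) (f : L → ℝ) (θ : I → ℝ) (z : L → ℝ) : Prop :=
  (∀ j, 0 ≤ g j ∧ g j ≤ N.P j) ∧
  (∀ i ∈ N.Ψ, 0 ≤ gw i ∧ gw i ≤ N.k i * u i) ∧
  (∀ i, i ∉ N.Ψ → gw i = 0) ∧
  (∀ i, 0 ≤ s i) ∧
  (∀ l, -N.fbar l ≤ f l ∧ f l ≤ N.fbar l) ∧
  (∀ i, -N.θbar ≤ θ i ∧ θ i ≤ N.θbar) ∧
  (∀ l, z l = 0 ∨ z l = 1) ∧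
  (∀ i, (∑ j ∈ univ.filter (fun j => N.loc j = i), g j) + gw i
      + (∑ l ∈ univ.filter (fun l => N.d l = i), f l) + s i
      = N.D i + ∑ l ∈ univ.filter (fun l => N.o l = i), f l) ∧
  (∀ l, f l = N.S l * (θ (N.o l) - θ (N.d l)) * z l)

/-- Market-clearing cost: generation cost plus load-shedding penalties. -/
def clearingCost (p : Ω → ℝ) (ρ : I → ℝ) (g : Ω → ℝ) (s : I → ℝ) : ℝ :=
  (∑ j, p j * g j) + ∑ i, ρ i * s i

/-- if the demand in `V` strictly exceeds the available fuel-based and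
wind generation in `V`, then any market-clearing solution with no load shedding in `V`
keeps at least one line of the cut between `V` and `W` switched on. -/
theorem no_shedding_needs_cut_line (N : PowerNetwork I L Ω)
    (V W : Finset I) (hVW : V ∪ W = univ) (hdisj : V ∩ W = ∅)
    (u : I → ℝ) (g : Ω → ℝ) (gw s : I → ℝ) (f : L → ℝ) (θ : I → ℝ) (z : L → ℝ)
    (hmc : IsMarketClearing N u g gw s f θ z)
    (hshort : (∑ j ∈ univ.filter (fun j => N.loc j ∈ V), N.P j)
        + (∑ i ∈ N.Ψ ∩ V, N.k i * u i) < ∑ i ∈ V, N.D i)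
    (hs : ∀ i ∈ V, s i = 0) :
    1 ≤ ∑ l ∈ univ.filter
          (fun l => (N.o l ∈ V ∧ N.d l ∈ W) ∨ (N.o l ∈ W ∧ N.d l ∈ V)), z l := by
  obtain ⟨hg, hgw, hgw0, -, -, -, hz, hbal, hf⟩ := hmc
  by_contra! hlt
  have hz_nonneg : ∀ l, 0 ≤ z l := fun l => by rcases hz l with h | h <;> simp [h]
  have mem_W : ∀ i, i ∉ V → i ∈ W := fun i hi =>
    (mem_union.mp (hVW ▸ mem_univ i)).resolve_left hi
  have hf_cut : ∀ l, (N.o l ∈ V ∧ N.d l ∈ W) ∨ (N.o l ∈ W ∧ N.d l ∈ V) → f l = 0 := by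
    intro l hl
    have hle := single_le_sum (f := z) (fun l _ => hz_nonneg l)
      (mem_filter.mpr ⟨mem_univ l, hl⟩ : l ∈ univ.filter
        (fun l => (N.o l ∈ V ∧ N.d l ∈ W) ∨ (N.o l ∈ W ∧ N.d l ∈ V)))
    have hzl : z l = 0 := (hz l).resolve_right fun h => by linarith
    rw [hf l, hzl, mul_zero]
  have hflow : ∑ l ∈ univ.filter (fun l => N.d l ∈ V), f l
      = ∑ l ∈ univ.filter (fun l => N.o l ∈ V), f l := by
    rw [sum_filter, sum_filter]
    refine sum_congr rfl fun l _ => ?_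
    by_cases ho : N.o l ∈ V <;> by_cases hd : N.d l ∈ V
    · simp [ho, hd]
    · simp [hf_cut l (.inl ⟨ho, mem_W _ hd⟩)]
    · simp [hf_cut l (.inr ⟨mem_W _ ho, hd⟩)]
    · simp [ho, hd]
  have hfuel : ∑ j ∈ univ.filter (fun j => N.loc j ∈ V), g j
      ≤ ∑ j ∈ univ.filter (fun j => N.loc j ∈ V), N.P j :=
    sum_le_sum fun j _ => (hg j).2
  have hwind : ∑ i ∈ V, gw i ≤ ∑ i ∈ N.Ψ ∩ V, N.k i * u i := by
    rw [← sum_subset inter_subset_right fun i hi hn =>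
      hgw0 i fun h => hn (mem_inter.mpr ⟨h, hi⟩)]
    exact sum_le_sum fun i hi => (hgw i (mem_inter.mp hi).1).2
  have hsum := sum_congr (rfl : V = V) fun i _ => hbal i
  simp only [sum_add_distrib, sum_fiberwise_eq_sum_filter, sum_eq_zero hs] at hsum
  linarith
end

section
/- Let (V, W) be a partition of I (V ∪ W = I, V ∩ W = ∅) and let L(V,W) be the set of lines with one endpoint in V and the other in W. Then every market-clearing solution with no load shedding in V (s_i = 0 for all i ∈ V) satisfies the capacity-strengthened cut inequality Σ_{l∈L(V,W)} f̄_l z_l ≥ Σ_{i∈V} D_i − Σ_{j : loc(j) ∈ V} P_j − Σ_{i∈Ψ∩V} k_i u_i (strengthening of the partition valid inequality by line capacities). -/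
open Finset

variable {I L Ω : Type*} [Fintype I] [Fintype L] [Fintype Ω] [DecidableEq I]

/-- capacity-strengthened cut inequality. With no load shedding in `V`,
the switched-on capacity of the cut between `V` and `W` covers the generation
shortfall of `V`. -/
theorem partition_capacity_inequality (N : PowerNetwork I L Ω)
    (V W : Finset I) (hVW : V ∪ W = univ) (hdisj : V ∩ W = ∅)
    (u : I → ℝ) (g : Ω → ℝ) (gw s : I → ℝ) (f : L → ℝ) (θ : I → ℝ) (z : L → ℝ)
    (hmc : IsMarketClearing N u g gw s f θ z)
    (hs : ∀ i ∈ V, s i = 0) :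
    (∑ i ∈ V, N.D i) - (∑ j ∈ univ.filter (fun j => N.loc j ∈ V), N.P j)
        - (∑ i ∈ N.Ψ ∩ V, N.k i * u i)
      ≤ ∑ l ∈ univ.filter
          (fun l => (N.o l ∈ V ∧ N.d l ∈ W) ∨ (N.o l ∈ W ∧ N.d l ∈ V)), N.fbar l * z l := by
  obtain ⟨hg, hgw, hgw0, -, hf, -, hz, hbal, hflow⟩ := hmc
  have hW (i : I) : i ∈ W ↔ i ∉ V := by
    have h₁ := Finset.ext_iff.mp hVW i
    have h₂ := Finset.ext_iff.mp hdisj i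
    simp only [mem_union, mem_univ, mem_inter, notMem_empty] at h₁ h₂
    tauto
  have hgen : ∑ j ∈ univ.filter (fun j => N.loc j ∈ V), g j
      ≤ ∑ j ∈ univ.filter (fun j => N.loc j ∈ V), N.P j :=
    sum_le_sum fun j _ => (hg j).2
  have hwind : ∑ i ∈ V, gw i ≤ ∑ i ∈ N.Ψ ∩ V, N.k i * u i := by
    rw [← sum_subset (inter_subset_right : N.Ψ ∩ V ⊆ V) fun i hi hi' =>
      hgw0 i fun h => hi' (mem_inter.mpr ⟨h, hi⟩)]
    exact sum_le_sum fun i hi => (hgw i (mem_inter.mp hi).1).2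
  have hnet : (∑ l ∈ univ.filter (fun l => N.d l ∈ V), f l)
        - ∑ l ∈ univ.filter (fun l => N.o l ∈ V), f l
      ≤ ∑ l ∈ univ.filter
          (fun l => (N.o l ∈ V ∧ N.d l ∈ W) ∨ (N.o l ∈ W ∧ N.d l ∈ V)), N.fbar l * z l := by
    simp only [sum_filter, ← sum_sub_distrib, hW]
    refine sum_le_sum fun l _ => ?_
    have hcap : -(N.fbar l * z l) ≤ f l ∧ f l ≤ N.fbar l * z l := by
      rcases hz l with h | h
      · simp [hflow l, h]
      · simpa [h] using hf l
    by_cases ho : N.o l ∈ V <;> by_cases hd : N.d l ∈ V <;> simp [ho, hd] <;> linarith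
  have hsum := sum_congr rfl fun i (_ : i ∈ V) => hbal i
  simp only [sum_add_distrib, sum_fiberwise_eq_sum_filter, sum_eq_zero hs] at hsum
  linarith
end
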